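/- Let F be a field, V a finite-dimensional F-vector space, A : V → V a linear endomorphism, n a positive integer, and σ a permutation of {1,…,n}. Let P_σ denote the linear automorphism of the n-th tensor power V^{⊗n} permuting the tensor factors according to σ, and let A^{⊗n} : V^{⊗n} → V^{⊗n} be the n-fold tensor power of A. Then the trace of the composite endomorphism P_σ ∘ A^{⊗n} equals the product over the cycles of σ of tr(A^r), where r runs over the cycle lengths: explicitly, tr(P_σ ∘ A^{⊗n}) = (tr A)^{f(σ)} · Π_{r ∈ cycleType(σ)} tr(A^r), where f(σ) is the number of fixed points of σ and cycleType(σ) is the multiset of lengths (≥ 2) of the nontrivial cycles of σ. Equivalently, tr(P_σ ∘ A^{⊗n}) = Π_{r≥1} (tr(A^r))^{l_r(σ)} where l_r(σ) is the number of length-r cycles of σ (counting fixed points as 1-cycles). -/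

import Mathlib

open scoped TensorProduct PiTensorProduct

namespace Equiv.Perm

section CycleType

variable {α β : Type*} [Fintype α] [DecidableEq α] [Fintype β] [DecidableEq β]

theorem cycleType_permCongr (e : α ≃ β) (σ : Perm α) :
    (e.permCongr σ).cycleType = σ.cycleType := by
  rw [← cycleType_extendDomain (e.trans (Equiv.subtypeUnivEquiv (p := fun _ => True)
    fun _ => trivial).symm) (g := σ)]
  congr 1

theorem cycleType_sumCongr_one (σ : Perm α) :
    (sumCongr σ (1 : Perm β)).cycleType = σ.cycleType := by
  rw [← cycleType_extendDomain (Equiv.ofInjective (Sum.inl : α → α ⊕ β) Sum.inl_injective)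
    (g := σ)]
  congr 1
  ext x
  rcases x with a | b
  · exact (extendDomain_apply_image σ (Equiv.ofInjective _ Sum.inl_injective) a).symm
  · rw [extendDomain_apply_not_subtype _ _ (by simp)]
    rfl

theorem cycleType_one_sumCongr (τ : Perm β) :
    (sumCongr (1 : Perm α) τ).cycleType = τ.cycleType := by
  rw [← cycleType_sumCongr_one (β := α) τ, ← cycleType_permCongr (Equiv.sumComm α β)]
  congr 1
  ext x
  rcases x with b | a <;> rfl

theorem cycleType_sumCongr (σ : Perm α) (τ : Perm β) :
    (sumCongr σ τ).cycleType = σ.cycleType + τ.cycleType := by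
  have h : Disjoint (sumCongr σ (1 : Perm β)) (sumCongr (1 : Perm α) τ) := by
    rintro (a | b) <;> simp
  rw [← cycleType_sumCongr_one (β := β) σ, ← cycleType_one_sumCongr (α := α) τ,
    ← h.cycleType_mul, sumCongr_mul, mul_one, one_mul]

end CycleType

end Equiv.Perm

namespace Matrix

open Equiv.Perm

variable {κ R : Type*} [Fintype κ] [CommRing R]

/-- The trace of the `ι`-indexed Kronecker power of `M` twisted by the permutation `σ`. -/
def permTrace {ι : Type*} [Fintype ι] [DecidableEq ι] (M : Matrix κ κ R)
    (σ : Equiv.Perm ι) : R :=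
  ∑ p : ι → κ, ∏ i, M (p i) (p (σ i))

section

variable {α β : Type*} [Fintype α] [DecidableEq α] [Fintype β] [DecidableEq β]

theorem permTrace_permCongr (M : Matrix κ κ R) (e : α ≃ β) (σ : Equiv.Perm α) :
    M.permTrace (e.permCongr σ) = M.permTrace σ := by
  unfold permTrace
  refine (Fintype.sum_equiv (e.arrowCongr (Equiv.refl κ)) _ _ fun p => ?_).symm
  exact Fintype.prod_equiv e _ _ fun i => by simp

theorem permTrace_sumCongr (M : Matrix κ κ R) (σ : Equiv.Perm α) (τ : Equiv.Perm β) :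
    M.permTrace (sumCongr σ τ) = M.permTrace σ * M.permTrace τ := by
  unfold permTrace
  rw [Finset.sum_mul_sum, ← Fintype.sum_prod_type']
  refine Fintype.sum_equiv (Equiv.sumArrowEquivProdArrow α β κ) _ _ fun p => ?_
  rw [Fintype.prod_sum_type]
  rfl

theorem permTrace_one (M : Matrix κ κ R) :
    M.permTrace (1 : Equiv.Perm α) = M.trace ^ Fintype.card α := by
  classical
  simp only [permTrace, Matrix.trace, Matrix.diag, coe_one, id]
  rw [← Finset.card_univ, ← Finset.prod_const, Finset.prod_univ_sum, Fintype.piFinset_univ]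

end

theorem pow_succ_apply_eq_sum [DecidableEq κ] (M : Matrix κ κ R) (n : ℕ) (a b : κ) :
    (M ^ (n + 1)) a b = ∑ p : Fin n → κ, ∏ i : Fin (n + 1),
      M (Fin.cons (α := fun _ => κ) a p i) (Fin.snoc (α := fun _ => κ) p b i) := by
  induction n generalizing a with
  | zero => simp [Fin.snoc]
  | succ n ih =>
    rw [pow_succ', Matrix.mul_apply, ← (Fin.consEquiv fun _ => κ).sum_comp,
      Fintype.sum_prod_type]
    refine Finset.sum_congr rfl fun c _ => ?_
    rw [ih, Finset.mul_sum]
    refine Finset.sum_congr rfl fun q _ => ?_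
    rw [Fin.prod_univ_succ (n := n + 1)]
    simp [Fin.consEquiv, ← Fin.cons_snoc_eq_snoc_cons]

theorem permTrace_finRotate [DecidableEq κ] (M : Matrix κ κ R) (n : ℕ) :
    M.permTrace (finRotate (n + 1)) = (M ^ (n + 1)).trace := by
  simp only [permTrace, Matrix.trace, Matrix.diag, pow_succ_apply_eq_sum,
    Fin.snoc_eq_cons_rotate]
  rw [← (Fin.consEquiv fun _ => κ).sum_comp, Fintype.sum_prod_type]
  rfl

theorem exists_perm_cycleType_permTrace [DecidableEq κ] (M : Matrix κ κ R) (k : ℕ)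
    (m : Multiset ℕ) (hm : ∀ r ∈ m, 2 ≤ r) :
    ∃ (α : Type) (_ : Fintype α) (_ : DecidableEq α) (τ : Equiv.Perm α),
      Fintype.card α = m.sum + k ∧ τ.cycleType = m ∧
        M.permTrace τ = M.trace ^ k * (m.map fun r => (M ^ r).trace).prod := by
  induction m using Multiset.induction_on with
  | empty => exact ⟨Fin k, inferInstance, inferInstance, 1, by simp, by simp, by
      simp [permTrace_one]⟩
  | cons r m ih =>
    obtain ⟨α, _, _, τ, hc, ht, hτ⟩ := ih fun s hs => hm s (Multiset.mem_cons_of_mem hs)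
    have hr := hm r (Multiset.mem_cons_self r m)
    refine ⟨Fin r ⊕ α, inferInstance, inferInstance, sumCongr (finRotate r) τ, ?_, ?_, ?_⟩
    · rw [Fintype.card_sum, hc, Fintype.card_fin, Multiset.sum_cons, add_assoc]
    · rw [cycleType_sumCongr, cycleType_finRotate_of_le hr, ht, Multiset.singleton_add]
    · obtain ⟨s, rfl⟩ : ∃ s, r = s + 1 := ⟨r - 1, by omega⟩
      rw [permTrace_sumCongr, permTrace_finRotate, hτ, Multiset.map_cons, Multiset.prod_cons]
      ring

theorem permTrace_eq [DecidableEq κ] {ι : Type*} [Fintype ι] [DecidableEq ι]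
    (M : Matrix κ κ R) (σ : Equiv.Perm ι) :
    M.permTrace σ = M.trace ^ (Finset.univ.filter fun i => σ i = i).card *
      (σ.cycleType.map fun r => (M ^ r).trace).prod := by
  obtain ⟨α, _, _, τ, hc, ht, hτ⟩ := M.exists_perm_cycleType_permTrace
    (Finset.univ.filter fun i => σ i = i).card σ.cycleType fun r => two_le_of_mem_cycleType
  have hcard : Fintype.card α = Fintype.card ι := by
    rw [hc, sum_cycleType, add_comm]
    exact Finset.card_filter_add_card_filter_not (s := Finset.univ) fun i => σ i = i
  let e : α ≃ ι := Fintype.equivOfCardEq hcard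
  obtain ⟨c, hconj⟩ := isConj_iff.mp
    (isConj_of_cycleType_eq ((cycleType_permCongr e τ).trans ht))
  have hσ : Equiv.permCongr c (e.permCongr τ) = σ := by
    rw [← hconj]
    rfl
  rw [← hτ, ← hσ, permTrace_permCongr, permTrace_permCongr]

end Matrix

theorem PiTensorProduct.trace_reindex_comp_map {R V ι κ : Type*} [CommRing R] [AddCommGroup V]
    [Module R V] [Fintype ι] [DecidableEq ι] [Fintype κ] [DecidableEq κ]
    (b : Module.Basis κ R V) (σ : Equiv.Perm ι) (A : V →ₗ[R] V) :
    LinearMap.trace R (⨂[R] _ : ι, V)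
        ((PiTensorProduct.reindex R (fun _ : ι => V) σ).toLinearMap ∘ₗ
          PiTensorProduct.map fun _ : ι => A) =
      (LinearMap.toMatrix b b A).permTrace σ⁻¹ := by
  rw [LinearMap.trace_eq_matrix_trace R (Basis.piTensorProduct fun _ : ι => b)]
  refine Finset.sum_congr rfl fun p _ => ?_
  rw [Matrix.diag_apply, LinearMap.toMatrix_apply, Basis.piTensorProduct_apply,
    LinearMap.comp_apply, PiTensorProduct.map_tprod, LinearEquiv.coe_coe,
    PiTensorProduct.reindex_tprod, Basis.piTensorProduct_repr_tprod_apply]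
  exact Finset.prod_congr rfl fun i _ => (LinearMap.toMatrix_apply b b A _ _).symm

/-- Trace of a permutation-twisted tensor power: if `P_σ` permutes the factors of the
`n`-th tensor power `V^{⊗n}` according to the permutation `σ` and `A^{⊗n}` is the `n`-th
tensor power of an endomorphism `A` of a finite-dimensional vector space `V`, then
`tr(P_σ ∘ A^{⊗n}) = (tr A)^{#fixed points of σ} · ∏_{r ∈ cycleType σ} tr(A^r)`. -/
theorem trace_perm_comp_tensorPower_map {F V : Type*} [Field F] [AddCommGroup V]
    [Module F V] [FiniteDimensional F V] (n : ℕ) (hn : 0 < n) (σ : Equiv.Perm (Fin n))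
    (A : V →ₗ[F] V) :
    LinearMap.trace F (⨂[F] _ : Fin n, V)
        ((PiTensorProduct.reindex F (fun _ : Fin n => V) σ).toLinearMap ∘ₗ
          PiTensorProduct.map fun _ : Fin n => A) =
      (LinearMap.trace F V A) ^ (Finset.univ.filter fun i => σ i = i).card *
        (σ.cycleType.map fun r => LinearMap.trace F V (A ^ r)).prod := by
  let b := Module.finBasis F V
  have hfix : (Finset.univ.filter fun i => σ⁻¹ i = i) = Finset.univ.filter fun i => σ i = i :=
    Finset.filter_congr fun i _ => by rw [Equiv.Perm.inv_eq_iff_eq, eq_comm]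
  rw [PiTensorProduct.trace_reindex_comp_map b, Matrix.permTrace_eq, Equiv.Perm.cycleType_inv,
    hfix]
  simp only [LinearMap.trace_eq_matrix_trace F b, LinearMap.toMatrix_pow]
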